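/- Let k ≥ 1 be an integer and let M be a k×k matrix over the Laurent polynomial ring ℂ[z, z⁻¹] whose determinant is a unit of ℂ[z, z⁻¹] (i.e., of the form c·z^r with c ∈ ℂ^×, r ∈ ℤ). Then there exist integers m₁ ≥ m₂ ≥ ⋯ ≥ m_k, a k×k matrix P over ℂ[z] whose determinant is a nonzero constant, and a k×k matrix Q over ℂ[z⁻¹] whose determinant is a nonzero constant, such that M = P · diag(z^{m₁}, ..., z^{m_k}) · Q in matrices over ℂ[z, z⁻¹]. Moreover, the nonincreasing tuple (m₁, ..., m_k) is uniquely determined by M. -/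

import Mathlib

open LaurentPolynomial

/-- `BirkhoffFact M m` says that the k×k Laurent-polynomial matrix `M` factors as
`P · diag(z^{m₁},…,z^{m_k}) · Q` with `P` a matrix over ℂ[z] with nonzero constant
determinant and `Q` a matrix over ℂ[z⁻¹] (realized as the image of a polynomial matrix
under z ↦ z⁻¹) with nonzero constant determinant. -/
def BirkhoffFact {k : ℕ} (M : Matrix (Fin k) (Fin k) (LaurentPolynomial ℂ))
    (m : Fin k → ℤ) : Prop :=
  ∃ P Q : Matrix (Fin k) (Fin k) (Polynomial ℂ),
    (∃ c : ℂ, c ≠ 0 ∧ P.det = Polynomial.C c) ∧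
    (∃ c : ℂ, c ≠ 0 ∧ Q.det = Polynomial.C c) ∧
    M = P.map (Polynomial.toLaurent (R := ℂ)) *
          Matrix.diagonal (fun i => LaurentPolynomial.T (m i)) *
          Q.map (Polynomial.aeval (LaurentPolynomial.T (-1) : LaurentPolynomial ℂ))

lemma exists_ne_zero_eq_C_iff_isUnit {p : Polynomial ℂ} :
    (∃ c : ℂ, c ≠ 0 ∧ p = Polynomial.C c) ↔ IsUnit p := by
  simp [Polynomial.isUnit_iff, eq_comm]

lemma aeval_T_neg_one_eq_invert (p : Polynomial ℂ) :
    Polynomial.aeval (T (-1) : LaurentPolynomial ℂ) p = invert (Polynomial.toLaurent p) := by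
  have h : Polynomial.aeval (T (-1) : LaurentPolynomial ℂ) =
      (invert (R := ℂ)).toAlgHom.comp Polynomial.toLaurentAlg := by
    ext1
    simp
  rw [h]
  simp

lemma invert_invert (f : LaurentPolynomial ℂ) : invert (invert f) = f :=
  involutive_invert f

lemma le_of_toLaurent_mul_T_eq {a b : Polynomial ℂ} {n n' : ℤ} (ha : a ≠ 0)
    (h : Polynomial.toLaurent a * T n =
      T n' * Polynomial.aeval (T (-1) : LaurentPolynomial ℂ) b) : n ≤ n' := by
  by_contra! hlt
  obtain ⟨s, hs⟩ := Int.eq_ofNat_of_zero_le (sub_pos.2 hlt).le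
  have hrev : Polynomial.toLaurent b.reverse =
      Polynomial.toLaurent (a * Polynomial.X ^ (s + b.natDegree)) := by
    rw [toLaurent_reverse, ← aeval_T_neg_one_eq_invert, map_mul, Polynomial.toLaurent_X_pow]
    have hn : ((s + b.natDegree : ℕ) : ℤ) = n + (-n' + b.natDegree) := by push_cast; omega
    rw [hn, T_add n, ← mul_assoc, h, T_add, mul_comm (T n'), mul_assoc, ← mul_assoc (T n'),
      ← T_add, add_neg_cancel, T_zero, one_mul]
  have hdeg := congrArg Polynomial.natDegree (Polynomial.toLaurent_injective hrev)
  rw [Polynomial.natDegree_mul_X_pow _ ha] at hdeg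
  have := b.reverse_natDegree_le
  omega

lemma le_of_antitone_of_le_perm {k : ℕ} {m m' : Fin k → ℤ} (hm : Antitone m) (hm' : Antitone m')
    (σ : Equiv.Perm (Fin k)) (h : ∀ i, m i ≤ m' (σ i)) : m ≤ m' := by
  intro l
  obtain ⟨i, hi, hl⟩ : ∃ i ≤ l, l ≤ σ i := by
    by_contra! hc
    have := Finset.card_le_card_of_injOn (s := Finset.Iic l) (t := Finset.Iio l) σ
      (fun i hi => by simpa using hc i (by simpa using hi)) σ.injective.injOn
    simp at this
  exact (hm hi).trans ((h i).trans (hm' hl))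

lemma BirkhoffFact.le {k : ℕ} {M : Matrix (Fin k) (Fin k) (LaurentPolynomial ℂ)}
    {m m' : Fin k → ℤ} (hm : Antitone m) (hm' : Antitone m')
    (h : BirkhoffFact M m) (h' : BirkhoffFact M m') : m ≤ m' := by
  obtain ⟨P, Q, hP, hQ, rfl⟩ := h
  obtain ⟨P', Q', hP', hQ', h⟩ := h'
  rw [exists_ne_zero_eq_C_iff_isUnit] at hP hQ hP' hQ'
  set A := P'⁻¹ * P
  set B := Q' * Q⁻¹
  have hP1 : P'⁻¹.map (Polynomial.toLaurent (R := ℂ)) *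
      P'.map (Polynomial.toLaurent (R := ℂ)) = 1 := by
    rw [← Matrix.map_mul, Matrix.nonsing_inv_mul _ hP', Matrix.map_one _ (map_zero _) (map_one _)]
  have hQ1 : Q.map (Polynomial.aeval (T (-1) : LaurentPolynomial ℂ)) *
      Q⁻¹.map (Polynomial.aeval (T (-1) : LaurentPolynomial ℂ)) = 1 := by
    rw [← Matrix.map_mul, Matrix.mul_nonsing_inv _ hQ, Matrix.map_one _ (map_zero _) (map_one _)]
  have key : A.map (Polynomial.toLaurent (R := ℂ)) * Matrix.diagonal (fun i => T (m i)) =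
      Matrix.diagonal (fun i => T (m' i)) *
        B.map (Polynomial.aeval (T (-1) : LaurentPolynomial ℂ)) := by
    have := congrArg (fun N => P'⁻¹.map (Polynomial.toLaurent (R := ℂ)) * N *
      Q⁻¹.map (Polynomial.aeval (T (-1) : LaurentPolynomial ℂ))) h
    simp only [Matrix.mul_assoc, hQ1, Matrix.mul_one] at this
    simp only [← Matrix.mul_assoc, hP1, Matrix.one_mul] at this
    simpa only [A, B, Matrix.map_mul, Matrix.mul_assoc] using this
  have hA : A.det ≠ 0 := by
    rw [Matrix.det_mul]
    exact ((P'.isUnit_nonsing_inv_det hP').mul hP).ne_zero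
  rw [Matrix.det_apply] at hA
  obtain ⟨σ, -, hσ⟩ := Finset.exists_ne_zero_of_sum_ne_zero hA
  have hσ' : ∏ i, A (σ i) i ≠ 0 := fun h0 => hσ (by rw [h0, smul_zero])
  refine le_of_antitone_of_le_perm hm hm' σ fun i => ?_
  have hij := congrFun (congrFun key (σ i)) i
  rw [Matrix.mul_diagonal, Matrix.diagonal_mul, Matrix.map_apply, Matrix.map_apply] at hij
  exact le_of_toLaurent_mul_T_eq (Finset.prod_ne_zero_iff.1 hσ' i (Finset.mem_univ i)) hij

lemma BirkhoffFact.exists_antitone {k : ℕ} {M : Matrix (Fin k) (Fin k) (LaurentPolynomial ℂ)}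
    {m : Fin k → ℤ} (h : BirkhoffFact M m) : ∃ m', Antitone m' ∧ BirkhoffFact M m' := by
  obtain ⟨P, Q, hP, hQ, rfl⟩ := h
  rw [exists_ne_zero_eq_C_iff_isUnit] at hP hQ
  let σ := Tuple.sort (-m)
  have hsign : IsUnit ((Equiv.Perm.sign σ : ℤ) : Polynomial ℂ) :=
    (Equiv.Perm.sign σ).isUnit.map (Int.castRingHom (Polynomial ℂ))
  refine ⟨m ∘ σ, fun i j hij => by simpa using Tuple.monotone_sort (-m) hij,
    P.submatrix id σ, Q.submatrix σ id, ?_, ?_, ?_⟩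
  · rw [exists_ne_zero_eq_C_iff_isUnit, Matrix.det_permute']
    exact hsign.mul hP
  · rw [exists_ne_zero_eq_C_iff_isUnit, Matrix.det_permute]
    exact hsign.mul hQ
  · have hd : Matrix.diagonal (fun i => (T ((m ∘ σ) i) : LaurentPolynomial ℂ)) =
        (Matrix.diagonal fun i => T (m i)).submatrix σ σ := by
      rw [Matrix.submatrix_diagonal_equiv]
      rfl
    rw [← Matrix.submatrix_map, ← Matrix.submatrix_map, hd, Matrix.submatrix_mul_equiv,
      Matrix.submatrix_mul_equiv, Matrix.submatrix_id_id]

lemma Matrix.det_one_updateRow' {n R : Type*} [Fintype n] [DecidableEq n] [CommRing R]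
    (i : n) (v : n → R) : ((1 : Matrix n n R).updateRow i v).det = v i := by
  have h := Matrix.det_updateRow_sum (1 : Matrix n n R) i v
  have hv : ∑ k, v k • (1 : Matrix n n R) k = v := by
    ext j
    simp [Matrix.one_apply]
  rwa [hv, Matrix.det_one, smul_eq_mul, mul_one] at h

lemma exists_rowOperation {k n : ℕ} (d : Fin k → ℤ) (Q : Matrix (Fin k) (Fin k) (Polynomial ℂ))
    (hQ : ∃ c : ℂ, c ≠ 0 ∧ Q.det = Polynomial.C c * Polynomial.X ^ (n + 1)) :
    ∃ (E Q' : Matrix (Fin k) (Fin k) (Polynomial ℂ)) (d' : Fin k → ℤ), IsUnit E.det ∧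
      (∃ c : ℂ, c ≠ 0 ∧ Q'.det = Polynomial.C c * Polynomial.X ^ n) ∧
      E.map (Polynomial.toLaurent (R := ℂ)) * (Matrix.diagonal (fun i => T (d i)) *
        Q.map (Polynomial.aeval (T (-1) : LaurentPolynomial ℂ))) =
      Matrix.diagonal (fun i => T (d' i)) *
        Q'.map (Polynomial.aeval (T (-1) : LaurentPolynomial ℂ)) := by
  obtain ⟨c, hc, hdet⟩ := hQ
  have h0 : (Q.map (Polynomial.evalRingHom (0 : ℂ))).det = 0 := by
    rw [← RingHom.mapMatrix_apply, ← RingHom.map_det, hdet]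
    simp
  obtain ⟨v, hv0, hv⟩ := Matrix.exists_vecMul_eq_zero_iff.2 h0
  obtain ⟨i, hi, hmax⟩ := Finset.exists_max_image (Finset.univ.filter fun j => v j ≠ 0) d (by
    obtain ⟨j, hj⟩ := Function.ne_iff.1 hv0
    exact ⟨j, by simpa using hj⟩)
  simp only [Finset.mem_filter, Finset.mem_univ, true_and] at hi hmax
  let r : Fin k → Polynomial ℂ := Matrix.vecMul (fun j => Polynomial.C (v j)) Q
  let w : Fin k → Polynomial ℂ := fun b => (r b).divX
  have hr : r = (Polynomial.X : Polynomial ℂ) • w := by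
    ext1 b
    have hb : (r b).coeff 0 = 0 := by
      have := congrFun hv b
      simpa [r, Matrix.vecMul, dotProduct, Polynomial.coeff_zero_eq_eval_zero,
        Polynomial.eval_finsetSum] using this
    have := Polynomial.X_mul_divX_add (r b)
    rw [hb, map_zero, add_zero] at this
    exact this.symm
  have hdet' : (Polynomial.X : Polynomial ℂ) * (Q.updateRow i w).det = Polynomial.C (v i) * Q.det := by
    rw [← Matrix.det_updateRow_smul, ← hr,
      ← Matrix.det_one_updateRow' i (fun j => Polynomial.C (v j)), ← Matrix.det_mul,
      Matrix.updateRow_mul, Matrix.one_mul]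
  let e : Fin k → Polynomial ℂ := fun j => Polynomial.C (v j) * Polynomial.X ^ (d i - d j).toNat
  refine ⟨(1 : Matrix _ _ _).updateRow i e, Q.updateRow i w, Function.update d i (d i - 1),
    ?_, ⟨v i * c, mul_ne_zero hi hc, ?_⟩, ?_⟩
  · rw [Matrix.det_one_updateRow']
    simpa [e] using hi
  · apply mul_left_cancel₀ (Polynomial.X_ne_zero (R := ℂ))
    rw [hdet', hdet, map_mul, pow_succ]
    ring
  · rw [Matrix.map_updateRow, Matrix.map_one _ (map_zero _) (map_one _), Matrix.updateRow_mul,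
      Matrix.one_mul]
    ext1 a b
    rw [Matrix.diagonal_mul, Matrix.map_apply]
    rcases eq_or_ne a i with rfl | ha
    · rw [Matrix.updateRow_self, Matrix.updateRow_self, Function.update_self]
      have hterm : ∀ j, Polynomial.toLaurent (e j) * (T (d j) *
          Polynomial.aeval (T (-1) : LaurentPolynomial ℂ) (Q j b)) = T (d a) *
          Polynomial.aeval (T (-1) : LaurentPolynomial ℂ) (Polynomial.C (v j) * Q j b) := by
        intro j
        by_cases hj : v j = 0
        · simp [e, hj]
        · have hda : d a = ((d a - d j).toNat : ℤ) + d j := by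
            have := hmax j hj
            omega
          conv_rhs => rw [hda, T_add]
          rw [map_mul, map_mul, Polynomial.toLaurent_X_pow, Polynomial.toLaurent_C,
            Polynomial.aeval_C, ← C_eq_algebraMap]
          ring
      have hsum : Matrix.vecMul (Polynomial.toLaurent ∘ e)
          (Matrix.diagonal (fun i => T (d i)) *
            Q.map (Polynomial.aeval (T (-1) : LaurentPolynomial ℂ))) b =
          T (d a) * Polynomial.aeval (T (-1) : LaurentPolynomial ℂ) (r b) := by
        simp only [Matrix.vecMul, dotProduct, Matrix.diagonal_mul, Matrix.map_apply,
          Function.comp_apply, hterm, r, map_sum, Finset.mul_sum]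
      rw [hsum, hr, Pi.smul_apply, smul_eq_mul, map_mul, Polynomial.aeval_X, ← mul_assoc, ← T_add]
      rfl
    · rw [Matrix.updateRow_ne ha, Matrix.updateRow_ne ha, Function.update_of_ne ha,
        Matrix.diagonal_mul, Matrix.map_apply]

lemma exists_birkhoffFact_of_det_eq {k : ℕ} (n : ℕ) (d : Fin k → ℤ)
    (P Q : Matrix (Fin k) (Fin k) (Polynomial ℂ)) (hP : IsUnit P.det)
    (hQ : ∃ c : ℂ, c ≠ 0 ∧ Q.det = Polynomial.C c * Polynomial.X ^ n) :
    ∃ m, BirkhoffFact (P.map (Polynomial.toLaurent (R := ℂ)) *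
      Matrix.diagonal (fun i => T (d i)) *
      Q.map (Polynomial.aeval (T (-1) : LaurentPolynomial ℂ))) m := by
  induction n generalizing d P Q with
  | zero => exact ⟨d, P, Q, exists_ne_zero_eq_C_iff_isUnit.2 hP, by simpa using hQ, rfl⟩
  | succ n ih =>
    obtain ⟨E, Q', d', hE, hQ', h⟩ := exists_rowOperation d Q hQ
    have hPE : IsUnit (P * E⁻¹).det := by
      rw [Matrix.det_mul]
      exact hP.mul (E.isUnit_nonsing_inv_det hE)
    have := ih d' (P * E⁻¹) Q' hPE hQ'
    rwa [Matrix.mul_assoc, ← h, ← Matrix.mul_assoc, ← Matrix.map_mul, Matrix.mul_assoc P,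
      Matrix.nonsing_inv_mul _ hE, Matrix.mul_one, ← Matrix.mul_assoc] at this

lemma exists_aeval_T_neg_one_eq (f : LaurentPolynomial ℂ) :
    ∃ N : ℕ, ∀ n ≥ N, ∃ p : Polynomial ℂ,
      f = T n * Polynomial.aeval (T (-1) : LaurentPolynomial ℂ) p := by
  obtain ⟨N, p, hp⟩ := exists_T_pow (invert f)
  refine ⟨N, fun n hn => ⟨p * Polynomial.X ^ (n - N), ?_⟩⟩
  rw [aeval_T_neg_one_eq_invert, map_mul, hp, Polynomial.toLaurent_X_pow, mul_assoc, ← T_add,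
    map_mul, invert_invert, invert_T, mul_left_comm, ← T_add, Nat.cast_sub hn]
  simp

lemma exists_birkhoffFact {k : ℕ} (hk : 1 ≤ k) (M : Matrix (Fin k) (Fin k) (LaurentPolynomial ℂ))
    (hM : ∃ (c : ℂ) (r : ℤ), c ≠ 0 ∧ M.det = C c * T r) : ∃ m, BirkhoffFact M m := by
  obtain ⟨c, r, hc, hdet⟩ := hM
  choose N hN using fun i j => exists_aeval_T_neg_one_eq (M i j)
  let n : ℕ := r.natAbs + ∑ i, ∑ j, N i j
  have hn : ∀ i j, N i j ≤ n := fun i j =>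
    ((Finset.single_le_sum (f := N i) (fun _ _ => Nat.zero_le _) (Finset.mem_univ j)).trans
      (Finset.single_le_sum (f := fun i => ∑ j, N i j) (fun _ _ => Nat.zero_le _)
        (Finset.mem_univ i))).trans (Nat.le_add_left _ _)
  choose Q hQ using fun i j => hN i j n (hn i j)
  have hMQ : M = Matrix.diagonal (fun _ => T n) *
      (Matrix.of Q).map (Polynomial.aeval (T (-1) : LaurentPolynomial ℂ)) := by
    ext1 i j
    rw [Matrix.diagonal_mul, Matrix.map_apply, Matrix.of_apply, ← hQ]
  have hle : r ≤ k * n := by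
    have h1 : r ≤ n := Int.le_natAbs.trans (by exact_mod_cast Nat.le_add_right _ _)
    have h2 : (n : ℤ) ≤ k * n := le_mul_of_one_le_left (by positivity) (by exact_mod_cast hk)
    exact h1.trans h2
  obtain ⟨s, hs⟩ := Int.eq_ofNat_of_zero_le (sub_nonneg.2 hle)
  have hQdet : (Matrix.of Q).det = Polynomial.C c * Polynomial.X ^ s := by
    apply Polynomial.toLaurent_injective
    apply (invert (R := ℂ)).injective
    have h := hdet
    rw [hMQ, Matrix.det_mul, Matrix.det_diagonal, Finset.prod_const, Finset.card_univ,
      Fintype.card_fin, T_pow, ← AlgHom.mapMatrix_apply, ← AlgHom.map_det,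
      aeval_T_neg_one_eq_invert] at h
    rw [map_mul, Polynomial.toLaurent_X_pow, Polynomial.toLaurent_C, map_mul, invert_C, invert_T]
    have h' := congrArg (fun f => T (-(k * n : ℤ)) * f) h
    simp only [← mul_assoc, ← T_add, neg_add_cancel, T_zero, one_mul] at h'
    rw [h', mul_comm (T _) (C c), mul_assoc, ← T_add]
    congr 2
    omega
  have := exists_birkhoffFact_of_det_eq s (fun _ => (n : ℤ)) 1 (Matrix.of Q) (by simp)
    ⟨c, hc, hQdet⟩
  rwa [Matrix.map_one _ (map_zero _) (map_one _), Matrix.one_mul, ← hMQ] at this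

theorem birkhoff_factorization_grothendieck (k : ℕ) (hk : 1 ≤ k)
    (M : Matrix (Fin k) (Fin k) (LaurentPolynomial ℂ))
    (hM : ∃ (c : ℂ) (r : ℤ), c ≠ 0 ∧ M.det = LaurentPolynomial.C c * LaurentPolynomial.T r) :
    ∃ m : Fin k → ℤ, Antitone m ∧ BirkhoffFact M m ∧
      ∀ m' : Fin k → ℤ, Antitone m' → BirkhoffFact M m' → m' = m := by
  obtain ⟨m₀, h₀⟩ := exists_birkhoffFact hk M hM
  obtain ⟨m, hm, h⟩ := h₀.exists_antitone
  exact ⟨m, hm, h, fun m' hm' h' => le_antisymm (h'.le hm' hm h) (h.le hm hm' h')⟩
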